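/- arXiv:1802.09673 — 3 statements merged into one kernel-verified Lean document; each statement's English description precedes it below -/
import Mathlib

section
/- (Lemma 1) Fix an integer c ≥ 1 and a real 0 < p < 1, and set q = 1 − p. Let (N_k) be a sequence of positive integers tending to infinity and (m_k) a sequence of integers with m_k / N_k → p and, for all sufficiently large k, c ≤ m_k < N_k and c ≤ N_k − m_k. Then for every fixed integer y ≥ 0, the maximum negative hypergeometric probability mass function converges pointwise to the maximum negative binomial probability mass function: f_{N_k, m_k, c}(y) → C(2c+y−1, c−1) · (p^y + q^y) · (pq)^c as k → ∞. -/
open Filter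

/-- The maximum negative hypergeometric probability mass function (real-valued). -/
noncomputable def maxNegHyperPMF (N m c y : ℕ) : ℝ :=
  ((c : ℝ) / (2*c + y)) *
    (((m.choose (c + y) : ℝ) * ((N - m).choose c : ℝ)
      + (m.choose c : ℝ) * ((N - m).choose (c + y) : ℝ))
    / (N.choose (2*c + y) : ℝ))

/-- If `a k / N k → x` and `N k → ∞`, then `(a k).choose j / N k ^ j → x ^ j / j!`. -/
theorem tendsto_choose_div_pow {ι : Type*} {l : Filter ι} {a N : ι → ℕ} {x : ℝ}
    (hN : Tendsto (fun k => (N k : ℝ)) l atTop)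
    (ha : Tendsto (fun k => (a k : ℝ) / (N k : ℝ)) l (nhds x)) (j : ℕ) :
    Tendsto (fun k => ((a k).choose j : ℝ) / (N k : ℝ) ^ j) l
      (nhds (x ^ j / (j.factorial : ℝ))) := by
  induction j with
  | zero => simpa using tendsto_const_nhds
  | succ j ih =>
    have hj : Tendsto (fun k => (j : ℝ) / (N k : ℝ)) l (nhds 0) := hN.const_div_atTop _
    have h := (ih.mul (ha.sub hj)).div_const ((j : ℝ) + 1)
    have hlim : x ^ j / (j.factorial : ℝ) * (x - 0) / ((j : ℝ) + 1)
        = x ^ (j + 1) / ((j + 1).factorial : ℝ) := by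
      rw [Nat.factorial_succ]
      push_cast
      field_simp
      ring
    rw [hlim] at h
    refine h.congr fun k => ?_
    have hrec : ((a k).choose (j + 1) : ℝ) * (j + 1) = (a k).choose j * ((a k : ℝ) - j) := by
      rcases le_or_gt j (a k) with hle | hlt
      · rw [← Nat.cast_sub hle]
        exact_mod_cast Nat.choose_succ_right_eq (a k) j
      · simp [Nat.choose_eq_zero_of_lt hlt, Nat.choose_eq_zero_of_lt (hlt.trans j.lt_succ_self)]
    rw [← sub_div, div_mul_div_comm, ← hrec, ← pow_succ]
    field_simp

/-- Lemma 1: for fixed `c` and `m/N → p`, the maximum negative hypergeometric pmf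
converges pointwise to the maximum negative binomial pmf. -/
theorem maxNegHyper_tendsto_maxNegBinomial
    (c : ℕ) (hc : 1 ≤ c) (p : ℝ) (hp0 : 0 < p) (hp1 : p < 1)
    (N m : ℕ → ℕ)
    (hN : Tendsto (fun k => (N k : ℝ)) atTop atTop)
    (hm : Tendsto (fun k => (m k : ℝ) / (N k : ℝ)) atTop (nhds p))
    (hbounds : ∀ᶠ k in atTop, c ≤ m k ∧ m k < N k ∧ c ≤ N k - m k) :
    ∀ y : ℕ,
      Tendsto (fun k => maxNegHyperPMF (N k) (m k) c y) atTop
        (nhds (((2*c + y - 1).choose (c - 1) : ℝ) *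
          (p ^ y + (1 - p) ^ y) * (p * (1 - p)) ^ c)) := by
  intro y
  have hNpos : ∀ᶠ k in atTop, (0 : ℝ) < N k := hN.eventually_gt_atTop 0
  have hone : Tendsto (fun k => (N k : ℝ) / (N k : ℝ)) atTop (nhds 1) :=
    tendsto_const_nhds.congr' <| hNpos.mono fun k hk => (div_self hk.ne').symm
  have hcompl : Tendsto (fun k => ((N k - m k : ℕ) : ℝ) / (N k : ℝ)) atTop (nhds (1 - p)) := by
    refine (hone.sub hm).congr' <| hbounds.mono fun k hk => ?_
    simp only [Nat.cast_sub hk.2.1.le, sub_div]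
  have hnum := ((tendsto_choose_div_pow hN hm (c + y)).mul (tendsto_choose_div_pow hN hcompl c)).add
    ((tendsto_choose_div_pow hN hm c).mul (tendsto_choose_div_pow hN hcompl (c + y)))
  have hlim := (hnum.div (tendsto_choose_div_pow hN hone (2 * c + y)) (by positivity)).const_mul
    ((c : ℝ) / (2 * c + y))
  convert hlim.congr' ?_ using 2
  · obtain ⟨d, rfl⟩ : ∃ d, c = d + 1 := ⟨c - 1, by omega⟩
    rw [mul_pow, show 2 * (d + 1) + y - 1 = d + (d + 1 + y) by omega, Nat.add_sub_cancel,
      Nat.cast_add_choose, show 2 * (d + 1) + y = d + (d + 1 + y) + 1 by omega,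
      Nat.factorial_succ (d + (d + 1 + y)), Nat.factorial_succ d]
    have hden : (2 * ((d : ℝ) + 1) + y) ≠ 0 := by positivity
    push_cast
    rw [show (d : ℝ) + (d + 1 + y) + 1 = 2 * (d + 1) + y by ring]
    field_simp
    ring
  · filter_upwards [hNpos] with k hk
    rw [maxNegHyperPMF]
    congr 1
    simp only [Pi.div_apply]
    rw [div_mul_div_comm, div_mul_div_comm, ← pow_add, ← pow_add,
      show c + y + c = 2 * c + y by ring, show c + (c + y) = 2 * c + y by ring, ← add_div,
      div_div_div_cancel_right₀ (pow_pos hk _).ne']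
end

section
/- (Lemma 2) Fix an integer c ≥ 1 and a real θ > 0. Let (N_k) be a sequence of positive integers tending to infinity and (m_k) integers with m_k / √(N_k) → θ and, for all sufficiently large k, c ≤ m_k < N_k and c ≤ N_k − m_k. Let Y_k have the maximum negative hypergeometric distribution with parameters (N_k, m_k, c). Then θ·Y_k/√(N_k) converges in distribution to the gamma distribution with shape c and rate 1 (the sum of c independent standard exponential random variables): for every bounded continuous function h : ℝ → ℝ, Σ_y f_{N_k,m_k,c}(y) · h(θ y / √(N_k)) → (1/Γ(c)) ∫_0^∞ h(x) x^{c−1} e^{−x} dx as k → ∞. -/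
open Filter

open Set MeasureTheory Topology

/-- Falling factorials of a smaller base are dominated by powers of the ratio of the bases. -/
lemma descFactorial_le_div_pow_mul {a b : ℕ} (hab : a ≤ b) (hb : 0 < b) (k : ℕ) :
    (a.descFactorial k : ℝ) ≤ ((a : ℝ) / b) ^ k * b.descFactorial k := by
  induction k with
  | zero => simp
  | succ k ih =>
    have hb' : (0 : ℝ) < b := by exact_mod_cast hb
    have hab' : (a : ℝ) ≤ b := by exact_mod_cast hab
    have step : ((a - k : ℕ) : ℝ) ≤ (a : ℝ) / b * ((b - k : ℕ) : ℝ) := by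
      rcases le_total k a with hk | hk
      · rw [Nat.cast_sub hk, Nat.cast_sub (hk.trans hab), div_mul_eq_mul_div, le_div_iff₀ hb']
        nlinarith [mul_le_mul_of_nonneg_left hab' (Nat.cast_nonneg (α := ℝ) k)]
      · rw [Nat.sub_eq_zero_of_le hk, Nat.cast_zero]
        positivity
    rw [Nat.descFactorial_succ, Nat.descFactorial_succ, Nat.cast_mul, Nat.cast_mul]
    calc ((a - k : ℕ) : ℝ) * a.descFactorial k
        ≤ ((a : ℝ) / b * ((b - k : ℕ) : ℝ)) * (((a : ℝ) / b) ^ k * b.descFactorial k) := by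
          gcongr
      _ = _ := by ring

/-- A lower bound for the ratio of two falling factorials. -/
lemma exp_mul_descFactorial_le {a b n : ℕ} (hab : a ≤ b) (hn : n < a) {k : ℕ} (hk : k ≤ n) :
    Real.exp (-(((b : ℝ) - a) / (a - n) * k)) * b.descFactorial k ≤ a.descFactorial k := by
  induction k with
  | zero => simp
  | succ k ih =>
    have hab' : (a : ℝ) ≤ b := by exact_mod_cast hab
    have hn' : (n : ℝ) < a := by exact_mod_cast hn
    have hk' : (k : ℝ) ≤ n := by exact_mod_cast (Nat.le_of_succ_le hk)
    have step : Real.exp (-(((b : ℝ) - a) / (a - n))) * ((b - k : ℕ) : ℝ) ≤ ((a - k : ℕ) : ℝ) := by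
      rw [Nat.cast_sub (by omega), Nat.cast_sub (by omega), Real.exp_neg, inv_mul_le_iff₀
        (Real.exp_pos _)]
      have h1 := Real.add_one_le_exp (((b : ℝ) - a) / (a - n))
      have h2 : ((b : ℝ) - a) / (a - k) ≤ ((b : ℝ) - a) / (a - n) :=
        div_le_div_of_nonneg_left (by linarith) (by linarith) (by linarith)
      calc (b : ℝ) - k = (((b : ℝ) - a) / (a - k) + 1) * (a - k) := by
            have : (a : ℝ) - k ≠ 0 := by linarith
            field_simp
            ring
        _ ≤ _ := mul_le_mul_of_nonneg_right (by linarith) (by linarith)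
    rw [Nat.descFactorial_succ, Nat.descFactorial_succ, Nat.cast_mul, Nat.cast_mul]
    calc _ = (Real.exp (-(((b : ℝ) - a) / (a - n))) * ((b - k : ℕ) : ℝ)) *
          (Real.exp (-(((b : ℝ) - a) / (a - n) * k)) * b.descFactorial k) := by
          rw [mul_mul_mul_comm, ← Real.exp_add]
          congr 2
          push_cast
          ring
      _ ≤ _ := mul_le_mul step (ih (by omega)) (by positivity) (by positivity)

/-- The probability that, drawing without replacement from `a` marked and `b` unmarked items among
`N`, the `c`-th marked item appears after exactly `c + y` unmarked ones. -/
noncomputable def negHyperTerm (N a b c y : ℕ) : ℝ :=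
  ((c : ℝ) / (2 * c + y)) *
    (((a.choose c : ℝ) * (b.choose (c + y) : ℝ)) / (N.choose (2 * c + y) : ℝ))

lemma maxNegHyperPMF_eq_add (N m c y : ℕ) :
    maxNegHyperPMF N m c y =
      negHyperTerm N (N - m) m c y + negHyperTerm N m (N - m) c y := by
  unfold maxNegHyperPMF negHyperTerm
  ring

lemma negHyperTerm_nonneg (N a b c y : ℕ) : 0 ≤ negHyperTerm N a b c y := by
  unfold negHyperTerm
  positivity

lemma negHyperTerm_eq_zero {N a b c y : ℕ} (h : b < c + y) : negHyperTerm N a b c y = 0 := by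
  simp [negHyperTerm, Nat.choose_eq_zero_of_lt h]

lemma negHyperTerm_eq {c : ℕ} (hc : 1 ≤ c) (N a b y : ℕ) :
    negHyperTerm N a b c y =
      1 / Real.Gamma c * ((c + y + 1).ascFactorial (c - 1) : ℝ) *
        ((a.descFactorial c : ℝ) / N.descFactorial c) *
        ((b.descFactorial (c + y) : ℝ) / (N - c).descFactorial (c + y)) := by
  obtain ⟨d, rfl⟩ : ∃ d, c = d + 1 := ⟨c - 1, by omega⟩
  have hΓ : Real.Gamma ((d + 1 : ℕ) : ℝ) = (d.factorial : ℝ) := by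
    rw [Nat.cast_succ, Real.Gamma_nat_eq_factorial]
  have hfac : ((2 * (d + 1) + y).factorial : ℝ) =
      (2 * (d + 1) + y) * ((d + 1 + y).factorial * ((d + 1 + y + 1).ascFactorial d)) := by
    have h := Nat.factorial_mul_ascFactorial (d + 1 + y) d
    have h2 : 2 * (d + 1) + y = (d + 1 + y + d) + 1 := by ring
    rw [h2, Nat.factorial_succ, ← h]
    push_cast
    ring
  have hdesc : (N.descFactorial (2 * (d + 1) + y) : ℝ) =
      N.descFactorial (d + 1) * (N - (d + 1)).descFactorial (d + 1 + y) := by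
    have h := Nat.descFactorial_mul_descFactorial (n := N)
      (show d + 1 ≤ 2 * (d + 1) + y by omega)
    rw [← h, show 2 * (d + 1) + y - (d + 1) = d + 1 + y by omega, Nat.cast_mul, mul_comm]
  have hch (n k : ℕ) : (n.choose k : ℝ) = n.descFactorial k / k.factorial := by
    rw [Nat.descFactorial_eq_factorial_mul_choose]
    have := k.factorial_ne_zero
    push_cast
    field_simp
  unfold negHyperTerm
  rw [hch, hch, hch, hΓ, hdesc, hfac, Nat.factorial_succ]
  have h1 : ((d + 1 + y).factorial : ℝ) ≠ 0 := by positivity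
  have h2 : (d.factorial : ℝ) ≠ 0 := by positivity
  have h3 : (2 * ((d : ℝ) + 1) + y) ≠ 0 := by positivity
  push_cast
  field_simp

lemma integral_comp_floor_div {δ : ℝ} (hδ : 0 < δ) (F : ℕ → ℝ) {n : ℕ}
    (hF : ∀ y, n ≤ y → F y = 0) :
    ∫ x in Ioi (0 : ℝ), F ⌊x / δ⌋₊ = δ * ∑ y ∈ Finset.range n, F y := by
  rw [← integral_Ici_eq_integral_Ioi]
  have key : ∀ x ∈ Ici (0 : ℝ), F ⌊x / δ⌋₊ =
      ∑ y ∈ Finset.range n, (Ico (y * δ) ((y + 1) * δ)).indicator (fun _ => F y) x := by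
    intro x hx
    have hmem (y : ℕ) : x ∈ Ico (y * δ) ((y + 1) * δ) ↔ ⌊x / δ⌋₊ = y := by
      rw [Nat.floor_eq_iff (div_nonneg hx hδ.le), le_div_iff₀ hδ, div_lt_iff₀ hδ, mem_Ico]
    simp only [indicator_apply, hmem, Finset.sum_ite_eq, Finset.mem_range]
    split_ifs with h
    · rfl
    · exact hF _ (not_lt.mp h)
  rw [setIntegral_congr_fun measurableSet_Ici key, integral_finsetSum, Finset.mul_sum]
  · refine Finset.sum_congr rfl fun y _ => ?_
    have hsub : Ico (y * δ) ((y + 1) * δ) ⊆ Ici 0 := fun x hx =>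
      (by positivity : (0 : ℝ) ≤ y * δ).trans hx.1
    rw [setIntegral_indicator measurableSet_Ico, inter_eq_self_of_subset_right hsub,
      setIntegral_const, Real.volume_real_Ico_of_le (by nlinarith), smul_eq_mul]
    ring
  · intro y _
    refine Integrable.integrableOn ?_
    exact (integrable_indicator_iff measurableSet_Ico).2 (integrableOn_const (by simp))

section Asymptotics

variable {c : ℕ} {θ : ℝ} {N m : ℕ → ℕ}

lemma tendsto_sqrt_cast (hN : Tendsto (fun k => (N k : ℝ)) atTop atTop) :
    Tendsto (fun k => √(N k : ℝ)) atTop atTop :=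
  Real.tendsto_sqrt_atTop.comp hN

lemma tendsto_const_div_sqrt_cast (hN : Tendsto (fun k => (N k : ℝ)) atTop atTop) (a : ℝ) :
    Tendsto (fun k => a / √(N k : ℝ)) atTop (𝓝 0) :=
  (tendsto_sqrt_cast hN).const_div_atTop a

lemma tendsto_div_cast_zero {a : ℕ → ℝ} {t : ℝ} (hN : Tendsto (fun k => (N k : ℝ)) atTop atTop)
    (ha : Tendsto (fun k => a k / √(N k : ℝ)) atTop (𝓝 t)) :
    Tendsto (fun k => a k / (N k : ℝ)) atTop (𝓝 0) := by
  have h := ha.mul (tendsto_const_div_sqrt_cast hN 1)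
  rw [mul_zero] at h
  refine h.congr fun k => ?_
  rw [div_mul_div_comm, mul_one, Real.mul_self_sqrt (Nat.cast_nonneg _)]

/-- If `a / √N → s`, `b / √N → t` and `d / N → 0`, then `a b / (N - d) → s t`. -/
lemma tendsto_div_sub_mul {a b d : ℕ → ℝ} {s t : ℝ}
    (hN : Tendsto (fun k => (N k : ℝ)) atTop atTop)
    (ha : Tendsto (fun k => a k / √(N k : ℝ)) atTop (𝓝 s))
    (hb : Tendsto (fun k => b k / √(N k : ℝ)) atTop (𝓝 t))
    (hd : Tendsto (fun k => d k / (N k : ℝ)) atTop (𝓝 0)) :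
    Tendsto (fun k => a k / (N k - d k) * b k) atTop (𝓝 (s * t)) := by
  have h := (ha.mul hb).div (hd.const_sub 1) (by norm_num)
  rw [sub_zero, div_one] at h
  refine h.congr' ?_
  filter_upwards [hN.eventually_gt_atTop 0] with k hk
  have hs : √(N k : ℝ) ≠ 0 := (Real.sqrt_pos.2 hk).ne'
  have h1 : (1 : ℝ) - d k / N k = (N k - d k) / (√(N k : ℝ) * √(N k : ℝ)) := by
    rw [Real.mul_self_sqrt hk.le]
    field_simp
  rw [Pi.div_apply, h1, div_mul_div_comm, div_div_div_cancel_right₀ (mul_ne_zero hs hs)]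
  ring

lemma tendsto_descFactorial_div (c : ℕ) (hθ : 0 < θ)
    (hN : Tendsto (fun k => (N k : ℝ)) atTop atTop)
    (hm : Tendsto (fun k => (m k : ℝ) / √(N k : ℝ)) atTop (𝓝 θ)) :
    Tendsto (fun k => ((m k).descFactorial c : ℝ) / (N k).descFactorial c / (θ / √(N k : ℝ)) ^ c)
      atTop (𝓝 1) := by
  have hmtop : Tendsto (fun k => (m k : ℝ)) atTop atTop := by
    refine (hm.pos_mul_atTop hθ (tendsto_sqrt_cast hN)).congr' ?_
    filter_upwards [hN.eventually_gt_atTop 0] with k hk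
    exact div_mul_cancel₀ _ (Real.sqrt_pos.2 hk).ne'
  induction c with
  | zero => simp
  | succ c ih =>
    have hmc : Tendsto (fun k => ((m k : ℝ) - c) / √(N k : ℝ)) atTop (𝓝 θ) := by
      simpa [sub_div] using hm.sub (tendsto_const_div_sqrt_cast hN c)
    have hθc : Tendsto (fun k => (θ⁻¹ * √(N k : ℝ)) / √(N k : ℝ)) atTop (𝓝 θ⁻¹) := by
      refine tendsto_const_nhds.congr' ?_
      filter_upwards [hN.eventually_gt_atTop 0] with k hk
      exact (mul_div_cancel_right₀ _ (Real.sqrt_pos.2 hk).ne').symm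
    have h := (tendsto_div_sub_mul hN hmc hθc
      (tendsto_div_cast_zero hN (tendsto_const_div_sqrt_cast hN c))).mul ih
    rw [mul_inv_cancel₀ hθ.ne', one_mul] at h
    refine h.congr' ?_
    filter_upwards [hN.eventually_ge_atTop (c : ℝ), hmtop.eventually_ge_atTop (c : ℝ)]
      with k hk hmk
    rw [Nat.descFactorial_succ, Nat.descFactorial_succ, Nat.cast_mul, Nat.cast_mul,
      Nat.cast_sub (by exact_mod_cast hmk), Nat.cast_sub (by exact_mod_cast hk), pow_succ]
    simp only [div_eq_mul_inv, mul_inv, inv_inv]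
    ring

lemma descFactorial_sub_div_le {N m c : ℕ} (hcm : c ≤ m) (hmN : m < N) (n : ℕ) :
    ((N - m).descFactorial n : ℝ) / (N - c).descFactorial n ≤
      Real.exp (-(((m : ℝ) - c) / (N - c) * n)) := by
  have hcN : (0 : ℝ) < (N : ℝ) - c := sub_pos.2 (by exact_mod_cast hcm.trans_lt hmN)
  refine (div_le_of_le_mul₀ (by positivity) (by positivity)
    (descFactorial_le_div_pow_mul (show N - m ≤ N - c by omega) (by omega) n)).trans ?_
  rw [mul_comm _ (n : ℝ), ← mul_neg, Real.exp_nat_mul]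
  gcongr
  rw [Nat.cast_sub hmN.le, Nat.cast_sub (hcm.trans hmN.le)]
  refine le_of_eq_of_le ?_ (Real.add_one_le_exp _)
  field_simp
  ring

lemma tendsto_descFactorial_sub_div {y : ℕ → ℕ} {x : ℝ} (hθ : 0 < θ)
    (hN : Tendsto (fun k => (N k : ℝ)) atTop atTop)
    (hm : Tendsto (fun k => (m k : ℝ) / √(N k : ℝ)) atTop (𝓝 θ))
    (hcm : ∀ᶠ k in atTop, c ≤ m k ∧ m k < N k)
    (hy : Tendsto (fun k => (y k : ℝ) / √(N k : ℝ)) atTop (𝓝 (x / θ))) :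
    Tendsto (fun k => ((N k - m k).descFactorial (c + y k) : ℝ) /
      (N k - c).descFactorial (c + y k)) atTop (𝓝 (Real.exp (-x))) := by
  have hmc : Tendsto (fun k => ((m k : ℝ) - c) / √(N k : ℝ)) atTop (𝓝 θ) := by
    simpa [sub_div] using hm.sub (tendsto_const_div_sqrt_cast hN c)
  have hcy : Tendsto (fun k => ((c : ℝ) + y k) / √(N k : ℝ)) atTop (𝓝 (x / θ)) := by
    simpa [add_div] using (tendsto_const_div_sqrt_cast hN c).add hy
  have hθx : θ * (x / θ) = x := mul_div_cancel₀ x hθ.ne'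
  have hmcy : Tendsto (fun k => ((m k : ℝ) + (c + y k)) / (N k : ℝ)) atTop (𝓝 0) := by
    refine tendsto_div_cast_zero (t := θ + x / θ) hN ?_
    simpa [add_div] using hm.add hcy
  have hup := tendsto_div_sub_mul hN hmc hcy
    (tendsto_div_cast_zero hN (tendsto_const_div_sqrt_cast hN c))
  have hlow := tendsto_div_sub_mul hN hmc hcy hmcy
  rw [hθx] at hup hlow
  have hlt : ∀ᶠ k in atTop, m k + (c + y k) < N k := by
    filter_upwards [hmcy.eventually_lt_const one_pos, hN.eventually_gt_atTop 0] with k hk hk0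
    rw [div_lt_one hk0] at hk
    exact_mod_cast hk
  refine tendsto_of_tendsto_of_tendsto_of_le_of_le' ((Real.continuous_exp.tendsto _).comp hlow.neg)
    ((Real.continuous_exp.tendsto _).comp hup.neg) ?_ ?_
  · filter_upwards [hlt, hcm] with k hk hcmk
    have hpos : (0 : ℝ) < (N k - c).descFactorial (c + y k) := by
      exact_mod_cast Nat.descFactorial_pos.2 (by omega)
    rw [le_div_iff₀ hpos]
    have h := exp_mul_descFactorial_le (a := N k - m k) (b := N k - c) (n := c + y k) (by omega)
      (by omega) le_rfl
    rw [Nat.cast_sub (by omega), Nat.cast_sub (by omega)] at h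
    refine le_of_eq_of_le ?_ h
    simp only [Function.comp_apply]
    push_cast
    congr 4
    ring
  · filter_upwards [hcm] with k hcmk
    simpa using descFactorial_sub_div_le hcmk.1 hcmk.2 (c + y k)

lemma tendsto_ascFactorial_mul_pow (d : ℕ) {δ : ℕ → ℝ} {y : ℕ → ℕ} {x : ℝ}
    (hδ : Tendsto δ atTop (𝓝 0)) (hy : Tendsto (fun k => δ k * y k) atTop (𝓝 x)) :
    Tendsto (fun k => ((c + y k + 1).ascFactorial d : ℝ) * δ k ^ d) atTop (𝓝 (x ^ d)) := by
  induction d with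
  | zero => simp
  | succ d ih =>
    have h := ((hδ.mul_const ((c : ℝ) + 1 + d)).add hy).mul ih
    rw [zero_mul, zero_add, ← pow_succ'] at h
    refine h.congr fun k => ?_
    rw [Nat.ascFactorial_succ]
    push_cast
    ring

lemma inv_mul_negHyperTerm (hc : 1 ≤ c) {δ : ℝ} (hδ : δ ≠ 0) (N a b y : ℕ) :
    δ⁻¹ * negHyperTerm N a b c y =
      1 / Real.Gamma c * (((c + y + 1).ascFactorial (c - 1) : ℝ) * δ ^ (c - 1)) *
        ((a.descFactorial c : ℝ) / N.descFactorial c / δ ^ c) *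
        ((b.descFactorial (c + y) : ℝ) / (N - c).descFactorial (c + y)) := by
  obtain ⟨d, rfl⟩ : ∃ d, c = d + 1 := ⟨c - 1, by omega⟩
  rw [negHyperTerm_eq hc, Nat.add_sub_cancel]
  generalize ((N - (d + 1)).descFactorial (d + 1 + y) : ℝ) = u
  generalize (N.descFactorial (d + 1) : ℝ) = v
  field_simp
  ring

lemma tendsto_inv_mul_negHyperTerm {y : ℕ → ℕ} {x : ℝ} (hc : 1 ≤ c) (hθ : 0 < θ)
    (hN : Tendsto (fun k => (N k : ℝ)) atTop atTop)
    (hm : Tendsto (fun k => (m k : ℝ) / √(N k : ℝ)) atTop (𝓝 θ))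
    (hcm : ∀ᶠ k in atTop, c ≤ m k ∧ m k < N k)
    (hy : Tendsto (fun k => θ / √(N k : ℝ) * y k) atTop (𝓝 x)) :
    Tendsto (fun k => (θ / √(N k : ℝ))⁻¹ * negHyperTerm (N k) (m k) (N k - m k) c (y k)) atTop
      (𝓝 (1 / Real.Gamma c * x ^ (c - 1) * Real.exp (-x))) := by
  have hy' : Tendsto (fun k => (y k : ℝ) / √(N k : ℝ)) atTop (𝓝 (x / θ)) := by
    refine (hy.div_const θ).congr fun k => ?_
    field_simp
  have h := (((tendsto_ascFactorial_mul_pow (c := c) (c - 1)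
    (tendsto_const_div_sqrt_cast hN θ) hy).const_mul (1 / Real.Gamma c)).mul
    (tendsto_descFactorial_div c hθ hN hm)).mul (tendsto_descFactorial_sub_div hθ hN hm hcm hy')
  rw [mul_one] at h
  refine h.congr' ?_
  filter_upwards [hN.eventually_gt_atTop 0] with k hk
  exact (inv_mul_negHyperTerm hc (div_pos hθ (Real.sqrt_pos.2 hk)).ne' _ _ _ _).symm

lemma one_add_pow_mul_exp_le (d : ℕ) {u : ℝ} (hu : 0 ≤ u) :
    (1 + u) ^ d * Real.exp (-(u / 2)) ≤ 4 ^ d * d.factorial * Real.exp (1 - u / 4) := by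
  have h := Real.pow_div_factorial_le_exp ((1 + u) / 4) (by positivity) d
  rw [div_le_iff₀ (by positivity), div_pow, div_le_iff₀ (by positivity)] at h
  calc (1 + u) ^ d * Real.exp (-(u / 2))
      ≤ (Real.exp ((1 + u) / 4) * d.factorial * 4 ^ d) * Real.exp (-(u / 2)) := by gcongr
    _ = 4 ^ d * d.factorial * (Real.exp ((1 + u) / 4) * Real.exp (-(u / 2))) := by ring
    _ ≤ _ := by
      rw [← Real.exp_add]
      gcongr
      linarith

/-- An eventual exponential bound, uniform in `y`, for the rescaled probabilities. -/
lemma eventually_inv_mul_negHyperTerm_le (hc : 1 ≤ c) (hθ : 0 < θ)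
    (hN : Tendsto (fun k => (N k : ℝ)) atTop atTop)
    (hm : Tendsto (fun k => (m k : ℝ) / √(N k : ℝ)) atTop (𝓝 θ))
    (hcm : ∀ᶠ k in atTop, c ≤ m k ∧ m k < N k) :
    ∃ K : ℝ, ∀ᶠ k in atTop, ∀ y : ℕ,
      (θ / √(N k : ℝ))⁻¹ * negHyperTerm (N k) (m k) (N k - m k) c y ≤
        K * Real.exp (-(θ / √(N k : ℝ) * y / 4)) := by
  refine ⟨1 / Real.Gamma c * 2 * (4 ^ (c - 1) * (c - 1).factorial * Real.exp 1), ?_⟩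
  have hmc : Tendsto (fun k => ((m k : ℝ) - c) / √(N k : ℝ)) atTop (𝓝 θ) := by
    simpa [sub_div] using hm.sub (tendsto_const_div_sqrt_cast hN c)
  have hΓ : 0 < Real.Gamma c := Real.Gamma_pos_of_pos (by exact_mod_cast hc)
  filter_upwards [hcm, hN.eventually_gt_atTop 0,
    (tendsto_const_div_sqrt_cast hN (θ * (2 * c))).eventually_le_const one_pos,
    (tendsto_descFactorial_div c hθ hN hm).eventually_le_const one_lt_two,
    hmc.eventually_const_le (half_lt_self hθ)] with k hcmk hk h2c hdesc hmck y
  have hs : 0 < √(N k : ℝ) := Real.sqrt_pos.2 hk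
  have hss : √(N k : ℝ) * √(N k : ℝ) = N k := Real.mul_self_sqrt hk.le
  have hcN : (c : ℝ) < N k := by exact_mod_cast hcmk.1.trans_lt hcmk.2
  have hmc0 : (0 : ℝ) ≤ (m k : ℝ) - c := sub_nonneg.2 (by exact_mod_cast hcmk.1)
  set δ := θ / √(N k : ℝ) with hδ
  have hδ0 : 0 < δ := div_pos hθ hs
  have hasc : ((c + y + 1).ascFactorial (c - 1) : ℝ) * δ ^ (c - 1) ≤ (1 + δ * y) ^ (c - 1) := by
    have h : ((c + y + 1).ascFactorial (c - 1) : ℝ) ≤ (2 * c + y) ^ (c - 1) := by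
      have h := (Nat.ascFactorial_le_pow_add (c + y) (c - 1)).trans
        (Nat.pow_le_pow_left (show c + y + (c - 1) ≤ 2 * c + y by omega) _)
      exact_mod_cast h
    have h2c' : δ * (2 * c) ≤ 1 := by
      rw [hδ, div_mul_eq_mul_div]
      exact h2c
    calc _ ≤ (2 * c + y : ℝ) ^ (c - 1) * δ ^ (c - 1) := by gcongr
      _ = (δ * (2 * c) + δ * y) ^ (c - 1) := by rw [← mul_pow]; ring
      _ ≤ _ := by gcongr
  have hexp : ((N k - m k).descFactorial (c + y) : ℝ) / (N k - c).descFactorial (c + y) ≤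
      Real.exp (-(δ * y / 2)) := by
    refine (descFactorial_sub_div_le hcmk.1 hcmk.2 _).trans (Real.exp_le_exp.2 (neg_le_neg ?_))
    have h1 : δ / 2 ≤ ((m k : ℝ) - c) / (N k - c) := by
      calc δ / 2 = θ / 2 / √(N k : ℝ) := by rw [hδ]; ring
        _ ≤ ((m k : ℝ) - c) / √(N k : ℝ) / √(N k : ℝ) := by gcongr
        _ = ((m k : ℝ) - c) / N k := by rw [div_div, hss]
        _ ≤ _ := div_le_div_of_nonneg_left hmc0 (by linarith) (by linarith [c.cast_nonneg (α := ℝ)])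
    calc δ * y / 2 = δ / 2 * y := by ring
      _ ≤ ((m k : ℝ) - c) / (N k - c) * (c + y : ℕ) := by
        gcongr
        omega
  rw [inv_mul_negHyperTerm hc hδ0.ne']
  calc _ ≤ 1 / Real.Gamma c * (1 + δ * y) ^ (c - 1) * 2 * Real.exp (-(δ * y / 2)) := by
        gcongr
    _ = 1 / Real.Gamma c * 2 * ((1 + δ * y) ^ (c - 1) * Real.exp (-(δ * y / 2))) := by ring
    _ ≤ 1 / Real.Gamma c * 2 * (4 ^ (c - 1) * (c - 1).factorial * Real.exp (1 - δ * y / 4)) := by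
        exact mul_le_mul_of_nonneg_left (one_add_pow_mul_exp_le _ (by positivity)) (by positivity)
    _ = _ := by
        rw [sub_eq_add_neg, Real.exp_add]
        ring

lemma tendsto_sum_negHyperTerm_swap (hc : 1 ≤ c)
    (hN : Tendsto (fun k => (N k : ℝ)) atTop atTop)
    (hm : Tendsto (fun k => (m k : ℝ) / √(N k : ℝ)) atTop (𝓝 θ)) (n : ℕ → ℕ) :
    Tendsto (fun k => ∑ y ∈ Finset.range (n k), negHyperTerm (N k) (N k - m k) (m k) c y)
      atTop (𝓝 0) := by
  set S : ℝ := ∑' y : ℕ, ((y : ℝ) + 2 * c) ^ (c - 1) * (1 / 2) ^ y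
  have hsum : Summable fun y : ℕ => ((y : ℝ) + 2 * c) ^ (c - 1) * (1 / 2 : ℝ) ^ y := by
    have h := ((summable_pow_mul_geometric_of_norm_lt_one (R := ℝ) (c - 1)
      (r := 1 / 2) (by norm_num)).comp_injective (add_left_injective (2 * c))).mul_left
      ((2 : ℝ) ^ (2 * c))
    refine h.congr fun y => ?_
    simp only [Function.comp_apply, pow_add, one_div, inv_pow]
    push_cast
    field_simp
  have hΓ : 0 < Real.Gamma c := Real.Gamma_pos_of_pos (by exact_mod_cast hc)
  have hr : Tendsto (fun k => (m k : ℝ) / (N k - c)) atTop (𝓝 0) := by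
    have h := (tendsto_div_cast_zero hN hm).div ((tendsto_div_cast_zero hN
      (tendsto_const_div_sqrt_cast hN c)).const_sub 1) (by norm_num)
    rw [zero_div] at h
    refine h.congr' ?_
    filter_upwards [hN.eventually_gt_atTop 0] with k hk
    rw [Pi.div_apply, one_sub_div hk.ne', div_div_div_cancel_right₀ hk.ne']
  have hlim := (hr.const_mul (1 / Real.Gamma c)).mul_const S
  rw [mul_zero, zero_mul] at hlim
  refine squeeze_zero' (Eventually.of_forall fun k => Finset.sum_nonneg fun y _ =>
    negHyperTerm_nonneg ..) ?_ hlim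
  filter_upwards [hr.eventually_le_const (show (0 : ℝ) < 1 / 2 by norm_num),
    hN.eventually_gt_atTop (c : ℝ)] with k hrk hk
  have hcN : c < N k := by exact_mod_cast hk
  have hmN : m k ≤ N k - c := by
    rw [div_le_iff₀ (sub_pos.2 hk)] at hrk
    have : (m k : ℝ) ≤ (N k - c : ℕ) := by
      rw [Nat.cast_sub hcN.le]
      linarith
    exact_mod_cast this
  set r : ℝ := (m k : ℝ) / (N k - c) with hr_def
  have hr0 : 0 ≤ r := div_nonneg (Nat.cast_nonneg _) (sub_pos.2 hk).le
  have hterm (y : ℕ) : negHyperTerm (N k) (N k - m k) (m k) c y ≤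
      1 / Real.Gamma c * r * (((y : ℝ) + 2 * c) ^ (c - 1) * (1 / 2) ^ y) := by
    have hasc : ((c + y + 1).ascFactorial (c - 1) : ℝ) ≤ (y + 2 * c) ^ (c - 1) := by
      have h := (Nat.ascFactorial_le_pow_add (c + y) (c - 1)).trans
        (Nat.pow_le_pow_left (show c + y + (c - 1) ≤ y + 2 * c by omega) _)
      exact_mod_cast h
    have h1 : ((N k - m k).descFactorial c : ℝ) / (N k).descFactorial c ≤ 1 :=
      div_le_one_of_le₀ (by exact_mod_cast Nat.descFactorial_le c (Nat.sub_le _ _)) (by positivity)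
    have h2 : ((m k).descFactorial (c + y) : ℝ) / (N k - c).descFactorial (c + y) ≤
        r * (1 / 2) ^ y := by
      refine (div_le_of_le_mul₀ (by positivity) (by positivity)
        (descFactorial_le_div_pow_mul hmN (by omega) _)).trans ?_
      rw [Nat.cast_sub hcN.le, ← hr_def, show c + y = (c - 1 + y) + 1 by omega, pow_succ']
      gcongr
      calc r ^ (c - 1 + y) ≤ r ^ y := pow_le_pow_of_le_one hr0 (by linarith) (by omega)
        _ ≤ _ := by gcongr
    rw [negHyperTerm_eq hc]
    calc _ ≤ 1 / Real.Gamma c * ((y : ℝ) + 2 * c) ^ (c - 1) * 1 * (r * (1 / 2) ^ y) := by gcongr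
      _ = _ := by ring
  calc _ ≤ ∑ y ∈ Finset.range (n k),
        1 / Real.Gamma c * r * (((y : ℝ) + 2 * c) ^ (c - 1) * (1 / 2) ^ y) :=
      Finset.sum_le_sum fun y _ => hterm y
    _ ≤ 1 / Real.Gamma c * r * S := by
      rw [← Finset.mul_sum]
      gcongr
      exact hsum.sum_le_tsum _ fun y _ => by positivity

lemma tendsto_sum_negHyperTerm (hc : 1 ≤ c) (hθ : 0 < θ)
    (hN : Tendsto (fun k => (N k : ℝ)) atTop atTop)
    (hm : Tendsto (fun k => (m k : ℝ) / √(N k : ℝ)) atTop (𝓝 θ))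
    (hcm : ∀ᶠ k in atTop, c ≤ m k ∧ m k < N k) {n : ℕ → ℕ}
    (hn : ∀ k y, n k ≤ y → negHyperTerm (N k) (m k) (N k - m k) c y = 0)
    {h : ℝ → ℝ} (hh : Continuous h) {M : ℝ} (hM : ∀ x, |h x| ≤ M) :
    Tendsto (fun k => ∑ y ∈ Finset.range (n k),
      negHyperTerm (N k) (m k) (N k - m k) c y * h (θ * y / √(N k : ℝ))) atTop
      (𝓝 ((1 / Real.Gamma c) *
        ∫ x in Set.Ioi (0 : ℝ), h x * x ^ (c - 1) * Real.exp (-x))) := by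
  set δ : ℕ → ℝ := fun k => θ / √(N k : ℝ) with hδ
  have hδ0 : Tendsto δ atTop (𝓝 0) := tendsto_const_div_sqrt_cast hN θ
  have hδpos : ∀ᶠ k in atTop, 0 < δ k := by
    filter_upwards [hN.eventually_gt_atTop 0] with k hk
    exact div_pos hθ (Real.sqrt_pos.2 hk)
  set F : ℕ → ℕ → ℝ := fun k y =>
    (δ k)⁻¹ * negHyperTerm (N k) (m k) (N k - m k) c y * h (δ k * y) with hF
  obtain ⟨K, hK⟩ := eventually_inv_mul_negHyperTerm_le hc hθ hN hm hcm
  have hlim : Tendsto (fun k => ∫ x in Ioi (0 : ℝ), F k ⌊x / δ k⌋₊) atTop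
      (𝓝 (∫ x in Ioi (0 : ℝ), 1 / Real.Gamma c * x ^ (c - 1) * Real.exp (-x) * h x)) := by
    refine tendsto_integral_filter_of_dominated_convergence
      (fun x => |K| * Real.exp (1 / 4) * M * Real.exp (-(1 / 4) * x)) ?_ ?_ ?_ ?_
    · refine Eventually.of_forall fun k => Measurable.aestronglyMeasurable ?_
      exact (measurable_of_countable (F k)).comp (Nat.measurable_floor.comp
        (measurable_id.div_const _))
    · filter_upwards [hδpos, hK, hδ0.eventually_le_const one_pos] with k hk hKk hk1
      filter_upwards [ae_restrict_mem measurableSet_Ioi] with x hx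
      have hfloor : x - 1 ≤ δ k * ⌊x / δ k⌋₊ := by
        have h1 := (Nat.lt_floor_add_one (x / δ k)).le
        rw [div_le_iff₀ hk] at h1
        linarith
      rw [norm_mul, Real.norm_of_nonneg (mul_nonneg (inv_nonneg.2 hk.le)
        (negHyperTerm_nonneg ..)), Real.norm_eq_abs]
      calc _ ≤ |K| * Real.exp (-(δ k * ⌊x / δ k⌋₊ / 4)) * M :=
            mul_le_mul ((hKk _).trans (by gcongr; exact le_abs_self K)) (hM _) (abs_nonneg _)
              (by positivity)
        _ ≤ |K| * Real.exp (1 / 4 + -(1 / 4) * x) * M := by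
            have := (abs_nonneg _).trans (hM 0)
            gcongr
            linarith
        _ = _ := by
            rw [Real.exp_add]
            ring
    · exact (exp_neg_integrableOn_Ioi 0 (by norm_num)).const_mul _
    · filter_upwards [ae_restrict_mem measurableSet_Ioi] with x hx
      have hy : Tendsto (fun k => δ k * (⌊x / δ k⌋₊ : ℝ)) atTop (𝓝 x) := by
        have hinv : Tendsto (fun k => (δ k)⁻¹) atTop atTop :=
          tendsto_inv_nhdsGT_zero.comp (tendsto_nhdsWithin_iff.2 ⟨hδ0, hδpos⟩)
        refine ((tendsto_nat_floor_mul_div_atTop (le_of_lt hx)).comp hinv).congr fun k => ?_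
        rw [Function.comp_apply, div_inv_eq_mul, mul_comm, div_eq_mul_inv]
      exact (tendsto_inv_mul_negHyperTerm hc hθ hN hm hcm hy).mul ((hh.tendsto x).comp hy)
  have hint : ∫ x in Ioi (0 : ℝ), 1 / Real.Gamma c * x ^ (c - 1) * Real.exp (-x) * h x =
      1 / Real.Gamma c * ∫ x in Ioi (0 : ℝ), h x * x ^ (c - 1) * Real.exp (-x) := by
    rw [← integral_const_mul]
    congr 1 with x
    ring
  rw [← hint]
  refine hlim.congr' ?_
  filter_upwards [hδpos] with k hk
  rw [integral_comp_floor_div hk (F k) (fun y hy => by simp only [hF, hn k y hy]; ring),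
    Finset.mul_sum]
  refine Finset.sum_congr rfl fun y _ => ?_
  simp only [hF]
  rw [← mul_assoc, mul_inv_cancel_left₀ hk.ne', div_mul_eq_mul_div]

end Asymptotics

/-- Lemma 2: if `m` grows like `θ √N`, then `θ Y / √N` converges in distribution to
the gamma distribution with shape `c` and rate 1. -/
theorem maxNegHyper_gamma_limit
    (c : ℕ) (hc : 1 ≤ c) (θ : ℝ) (hθ : 0 < θ)
    (N m : ℕ → ℕ)
    (hN : Tendsto (fun k => (N k : ℝ)) atTop atTop)
    (hm : Tendsto (fun k => (m k : ℝ) / Real.sqrt (N k)) atTop (nhds θ))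
    (hbounds : ∀ᶠ k in atTop, c ≤ m k ∧ m k < N k ∧ c ≤ N k - m k) :
    ∀ h : ℝ → ℝ, Continuous h → (∃ M : ℝ, ∀ x, |h x| ≤ M) →
      Tendsto
        (fun k => ∑ y ∈ Finset.range (max (m k - c) (N k - m k - c) + 1),
          maxNegHyperPMF (N k) (m k) c y * h (θ * y / Real.sqrt (N k)))
        atTop
        (nhds ((1 / Real.Gamma c) *
          ∫ x in Set.Ioi (0:ℝ), h x * x ^ (c - 1) * Real.exp (-x))) := by
  intro h hh hbdd
  obtain ⟨M, hM⟩ := hbdd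
  have hM0 : 0 ≤ M := (abs_nonneg _).trans (hM 0)
  have hcm : ∀ᶠ k in atTop, c ≤ m k ∧ m k < N k := hbounds.mono fun k hk => ⟨hk.1, hk.2.1⟩
  set n : ℕ → ℕ := fun k => max (m k - c) (N k - m k - c) + 1
  have hswap : Tendsto (fun k => ∑ y ∈ Finset.range (n k),
      negHyperTerm (N k) (N k - m k) (m k) c y * h (θ * y / √(N k))) atTop (𝓝 0) := by
    refine squeeze_zero_norm (fun k => ?_)
      (by simpa using (tendsto_sum_negHyperTerm_swap hc hN hm n).mul_const M)
    rw [Finset.sum_mul]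
    refine norm_sum_le_of_le _ fun y _ => ?_
    rw [norm_mul, Real.norm_of_nonneg (negHyperTerm_nonneg ..)]
    exact mul_le_mul_of_nonneg_left (hM _) (negHyperTerm_nonneg ..)
  have hmain := hswap.add (tendsto_sum_negHyperTerm hc hθ hN hm hcm
    (fun k y hy => negHyperTerm_eq_zero (by
      have hy' : max (m k - c) (N k - m k - c) + 1 ≤ y := hy
      omega)) hh hM)
  rw [zero_add] at hmain
  refine hmain.congr fun k => ?_
  rw [← Finset.sum_add_distrib]
  refine Finset.sum_congr rfl fun y _ => ?_
  rw [maxNegHyperPMF_eq_add, add_mul]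
end

section
/- (Lemma 3) Let (N_k) be a sequence of even positive integers tending to infinity, set m_k = N_k/2, and let (c_k) be integers with c_k / √(N_k) → 1 and 1 ≤ c_k ≤ N_k/2 for all k. Let Y_k have the maximum negative hypergeometric distribution with parameters (N_k, m_k, c_k). Then Y_k/√(2c_k) converges in distribution to the standard half-normal (folded normal) distribution: for every bounded continuous function h : ℝ → ℝ, Σ_y f_{N_k,m_k,c_k}(y) · h(y / √(2c_k)) → ∫_0^∞ h(x) · √(2/π) · e^{−x²/2} dx as k → ∞. -/
open Filter

theorem maxNegHyperPMF_two_mul (n c y : ℕ) :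
    maxNegHyperPMF (2 * n) n c y =
      2 * c / (2 * c + y) * (n.choose (c + y) * n.choose c / (2 * n).choose (2 * c + y)) := by
  unfold maxNegHyperPMF
  rw [show 2 * n - n = n by omega]
  ring

theorem maxNegHyperPMF_two_mul_nonneg (n c y : ℕ) : 0 ≤ maxNegHyperPMF (2 * n) n c y := by
  rw [maxNegHyperPMF_two_mul]
  positivity

theorem maxNegHyperPMF_two_mul_eq_zero {n c y : ℕ} (hy : n < c + y) :
    maxNegHyperPMF (2 * n) n c y = 0 := by
  rw [maxNegHyperPMF_two_mul, Nat.choose_eq_zero_of_lt hy]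
  simp

theorem maxNegHyperPMF_two_mul_zero {n c : ℕ} (hc : 1 ≤ c) (hcn : c ≤ n) :
    maxNegHyperPMF (2 * n) n c 0 =
      c.centralBinom * (n - c).centralBinom / n.centralBinom := by
  obtain ⟨d, rfl⟩ := Nat.exists_eq_add_of_le hcn
  rw [maxNegHyperPMF_two_mul]
  simp only [Nat.centralBinom, add_zero, Nat.add_sub_cancel_left]
  rw [Nat.cast_add_choose, Nat.cast_choose ℝ (show 2 * c ≤ 2 * (c + d) by omega),
    Nat.cast_choose ℝ (show c ≤ 2 * c by omega), Nat.cast_choose ℝ (show d ≤ 2 * d by omega),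
    Nat.cast_choose ℝ (show c + d ≤ 2 * (c + d) by omega),
    show 2 * (c + d) - 2 * c = 2 * d by omega, show 2 * c - c = c by omega,
    show 2 * d - d = d by omega, show 2 * (c + d) - (c + d) = c + d by omega]
  have hc' : (c : ℝ) ≠ 0 := by positivity
  have h (k : ℕ) : (k.factorial : ℝ) ≠ 0 := by positivity
  have h1 := h c
  have h2 := h d
  have h3 := h (c + d)
  have h4 := h (2 * c)
  have h5 := h (2 * d)
  have h6 := h (2 * (c + d))
  push_cast
  field_simp
  simp

theorem maxNegHyperPMF_two_mul_succ {n c y : ℕ} (hc : 1 ≤ c) (hy : c + y < n) :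
    maxNegHyperPMF (2 * n) n c (y + 1) = maxNegHyperPMF (2 * n) n c y *
      ((2 * c + y) * (n - c - y) / ((c + y + 1) * (2 * (n - c - y) + y))) := by
  rw [maxNegHyperPMF_two_mul, maxNegHyperPMF_two_mul]
  have h1 : (n.choose (c + y + 1) : ℝ) = n.choose (c + y) * (n - c - y) / (c + y + 1) := by
    have := Nat.choose_succ_right_eq n (c + y)
    rw [eq_div_iff (by positivity)]
    have h := congrArg (Nat.cast : ℕ → ℝ) this
    push_cast [Nat.cast_sub hy.le] at h
    linarith
  have h2 : ((2 * n).choose (2 * c + y + 1) : ℝ) =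
      (2 * n).choose (2 * c + y) * (2 * (n - c - y) + y) / (2 * c + y + 1) := by
    have := Nat.choose_succ_right_eq (2 * n) (2 * c + y)
    rw [eq_div_iff (by positivity)]
    have h := congrArg (Nat.cast : ℕ → ℝ) this
    push_cast [Nat.cast_sub (show 2 * c + y ≤ 2 * n by omega)] at h
    linarith
  rw [← add_assoc, ← add_assoc, h1, h2]
  have hn : (c : ℝ) + y < n := by exact_mod_cast hy
  have h3 : (2 * ((n : ℝ) - c - y) + y) ≠ 0 := by
    have : (0 : ℝ) ≤ y := by positivity
    linarith
  have h4 : ((2 * n).choose (2 * c + y) : ℝ) ≠ 0 := by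
    exact_mod_cast (Nat.choose_pos (by omega)).ne'
  have h5 : (2 * (c : ℝ) + y) ≠ 0 := by positivity
  push_cast
  field_simp
  ring

theorem tendsto_centralBinom_mul_sqrt_div :
    Tendsto (fun k : ℕ => (k.centralBinom : ℝ) * √k / 4 ^ k) atTop (nhds (1 / √Real.pi)) := by
  have h := Stirling.tendsto_stirlingSeq_sqrt_pi
  have h2 := h.comp (tendsto_id.const_mul_atTop' (show 0 < 2 by norm_num) : Tendsto (fun k : ℕ => 2 * k) atTop atTop)
  have hpi : √Real.pi ≠ 0 := by positivity
  have h3 := h2.div (h.pow 2) (by positivity)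
  rw [show √Real.pi / √Real.pi ^ 2 = 1 / √Real.pi by field_simp] at h3
  refine h3.congr' ?_
  filter_upwards [eventually_gt_atTop 0] with k hk
  have hk' : (0 : ℝ) < k := by exact_mod_cast hk
  simp only [Pi.div_apply, Function.comp, Stirling.stirlingSeq, Nat.centralBinom]
  rw [Nat.cast_choose ℝ (show k ≤ 2 * k by omega), show 2 * k - k = k by omega]
  have hf : (k.factorial : ℝ) ≠ 0 := by positivity
  push_cast
  rw [show (2 : ℝ) * (2 * k) = 2 ^ 2 * k by ring, Real.sqrt_mul (by positivity),
    Real.sqrt_sq (by norm_num), div_pow ((k.factorial : ℝ)), mul_pow √(2 * (k : ℝ)), Real.sq_sqrt (by positivity),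
    show (2 * (k : ℝ) / Real.exp 1) = 2 * (k / Real.exp 1) by ring, mul_pow 2, pow_mul 2, pow_mul (k / Real.exp 1 : ℝ), pow_right_comm (k / Real.exp 1 : ℝ)]
  have hs : √(k : ℝ) * √k = k := Real.mul_self_sqrt hk'.le
  have hs0 : √(k : ℝ) ≠ 0 := by positivity
  norm_num
  field_simp
  rw [Real.sq_sqrt hk'.le]

theorem integral_Ioi_comp_floor (φ : ℕ → ℝ) {M : ℕ} (hφ : ∀ y, M ≤ y → φ y = 0) :
    ∫ x in Set.Ioi (0 : ℝ), φ ⌊x⌋₊ = ∑ y ∈ Finset.range M, φ y := by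
  have hcongr (y : ℕ) : Set.EqOn (fun x : ℝ => φ ⌊x⌋₊) (fun _ => φ y) (Set.Ico (y : ℝ) ((y + 1 : ℕ) : ℝ)) := by
    intro x hx
    have : ⌊x⌋₊ = y := (Nat.floor_eq_iff ((Nat.cast_nonneg y).trans hx.1)).2 (by simpa using hx)
    simp [this]
  have hy (y : ℕ) : (y : ℝ) ≤ ((y + 1 : ℕ) : ℝ) := by simp
  have hii (y : ℕ) : IntervalIntegrable (fun x : ℝ => φ ⌊x⌋₊) MeasureTheory.volume y (y + 1 : ℕ) := by
    rw [intervalIntegrable_iff_integrableOn_Ico_of_le (hy y)]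
    exact (MeasureTheory.integrableOn_const (by simp)).congr_fun (hcongr y).symm measurableSet_Ico
  have hval (y : ℕ) : ∫ x in (y : ℝ)..(y + 1 : ℕ), φ ⌊x⌋₊ = φ y := by
    rw [intervalIntegral.integral_of_le (hy y), ← MeasureTheory.integral_Ico_eq_integral_Ioc,
      MeasureTheory.setIntegral_congr_fun measurableSet_Ico (hcongr y)]
    simp
  have hsum := intervalIntegral.sum_integral_adjacent_intervals (a := fun y : ℕ => (y : ℝ))
    (n := M) (fun y _ => hii y)
  simp only [hval] at hsum
  rw [hsum, Nat.cast_zero, intervalIntegral.integral_of_le (by positivity)]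
  refine (MeasureTheory.setIntegral_eq_of_subset_of_forall_sdiff_eq_zero measurableSet_Ioi
    Set.Ioc_subset_Ioi_self ?_)
  rintro x ⟨hx, hx'⟩
  refine hφ _ (Nat.le_floor ?_)
  by_contra hlt
  exact hx' ⟨hx, (not_le.1 hlt).le⟩

theorem maxNegHyperPMF_two_mul_succ_le {n c : ℕ} (hc : 1 ≤ c) (y : ℕ) :
    maxNegHyperPMF (2 * n) n c (y + 1) ≤
      maxNegHyperPMF (2 * n) n c y * Real.exp (-((y + 2) / (2 * (c + y + 1)))) := by
  have h0 := maxNegHyperPMF_two_mul_nonneg n c y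
  rcases le_or_gt n (c + y) with hy | hy
  · rw [maxNegHyperPMF_two_mul_eq_zero (y := y + 1) (by omega)]
    positivity
  rw [maxNegHyperPMF_two_mul_succ hc hy]
  refine mul_le_mul_of_nonneg_left ?_ h0
  have hn : 0 < (n : ℝ) - c - y := by
    have : (c : ℝ) + y < n := by exact_mod_cast hy
    linarith
  refine le_trans ?_ (Real.add_one_le_exp _)
  have hy0 : (0 : ℝ) ≤ y := by positivity
  calc (2 * (c : ℝ) + y) * (n - c - y) / ((c + y + 1) * (2 * (n - c - y) + y))
      ≤ (2 * (c : ℝ) + y) * (n - c - y) / ((c + y + 1) * (2 * (n - c - y))) := by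
        gcongr
        linarith
    _ = -((y + 2) / (2 * (c + y + 1))) + 1 := by
        field_simp
        ring

theorem le_maxNegHyperPMF_two_mul_succ {n c y : ℕ} (hc : 1 ≤ c) (hy : c + y < n) :
    maxNegHyperPMF (2 * n) n c y * Real.exp (-((y + 2) / (2 * c) + y / (n - c - y))) ≤
      maxNegHyperPMF (2 * n) n c (y + 1) := by
  have h0 := maxNegHyperPMF_two_mul_nonneg n c y
  rw [maxNegHyperPMF_two_mul_succ hc hy]
  refine mul_le_mul_of_nonneg_left ?_ h0
  have hn : 0 < (n : ℝ) - c - y := by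
    have : (c : ℝ) + y < n := by exact_mod_cast hy
    linarith
  have hc1 : (1 : ℝ) ≤ c := by exact_mod_cast hc
  have hy0 : (0 : ℝ) ≤ y := by positivity
  generalize (n : ℝ) - c - y = u at hn ⊢
  have hr : 0 < (2 * (c : ℝ) + y) * u / ((c + y + 1) * (2 * u + y)) := by positivity
  rw [← Real.le_log_iff_exp_le hr]
  refine le_trans ?_ (Real.one_sub_inv_le_log_of_pos hr)
  have h1 : 1 - ((2 * (c : ℝ) + y) * u / ((c + y + 1) * (2 * u + y)))⁻¹ =
      -((y + 2) / (2 * c + y) + (c + y + 1) / (2 * c + y) * (y / u)) := by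
    field_simp
    ring
  rw [h1, neg_le_neg_iff]
  refine add_le_add ?_ ?_
  · gcongr
    linarith
  · refine mul_le_of_le_one_left (by positivity) ?_
    rw [div_le_one (by positivity)]
    linarith

theorem maxNegHyperPMF_two_mul_le_gaussian {n c : ℕ} (hc : 1 ≤ c) {y Y : ℕ} (hY : y ≤ Y) :
    maxNegHyperPMF (2 * n) n c y ≤
      maxNegHyperPMF (2 * n) n c 0 * Real.exp (-(y * (y - 1) / (4 * (c + Y)))) := by
  induction y with
  | zero => simp
  | succ y ih =>
    refine (maxNegHyperPMF_two_mul_succ_le hc y).trans ?_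
    refine (mul_le_mul_of_nonneg_right (ih (by omega)) (Real.exp_nonneg _)).trans ?_
    rw [mul_assoc, ← Real.exp_add]
    have h0 := maxNegHyperPMF_two_mul_nonneg n c 0
    gcongr
    have hY' : (y : ℝ) + 1 ≤ Y := by exact_mod_cast hY
    have hc1 : (1 : ℝ) ≤ c := by exact_mod_cast hc
    have h1 : (y : ℝ) / (2 * (c + Y)) ≤ (y + 2) / (2 * (c + y + 1)) := by
      rw [div_le_div_iff₀ (by positivity) (by positivity)]
      nlinarith
    have h2 : ((y + 1 : ℕ) : ℝ) * ((y + 1 : ℕ) - 1) / (4 * (c + Y)) =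
        y * (y - 1) / (4 * (c + Y)) + y / (2 * (c + Y)) := by
      push_cast
      field_simp
      ring
    rw [h2]
    linarith

theorem gaussian_le_maxNegHyperPMF_two_mul {n c : ℕ} (hc : 1 ≤ c) {y Y : ℕ} (hY : y ≤ Y)
    (hYn : c + Y < n) :
    maxNegHyperPMF (2 * n) n c 0 *
        Real.exp (-((y ^ 2 + 3 * y) / (4 * c) + y * Y / (n - c - Y))) ≤
      maxNegHyperPMF (2 * n) n c y := by
  induction y with
  | zero => simp
  | succ y ih =>
    refine le_trans ?_ (le_maxNegHyperPMF_two_mul_succ hc (by omega))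
    refine le_trans ?_ (mul_le_mul_of_nonneg_right (ih (by omega)) (Real.exp_nonneg _))
    rw [mul_assoc, ← Real.exp_add]
    have h0 := maxNegHyperPMF_two_mul_nonneg n c 0
    gcongr
    have hY' : (y : ℝ) + 1 ≤ Y := by exact_mod_cast hY
    have hn : 0 < (n : ℝ) - c - Y := by
      have : (c : ℝ) + Y < n := by exact_mod_cast hYn
      linarith
    have h1 : (y : ℝ) / (n - c - y) ≤ Y / (n - c - Y) := by
      gcongr <;> linarith
    have hc0 : (0 : ℝ) < c := by positivity
    have h2 : ((((y + 1 : ℕ) : ℝ)) ^ 2 + 3 * (y + 1 : ℕ)) / (4 * c) + (y + 1 : ℕ) * Y / (n - c - Y) =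
        ((y ^ 2 + 3 * y) / (4 * c) + y * Y / (n - c - Y)) +
          ((y + 2) / (2 * c) + Y / (n - c - Y)) := by
      have := hn.ne'
      push_cast
      field_simp
      ring
    rw [h2]
    linarith

theorem maxNegHyperPMF_two_mul_le_exp {n c : ℕ} (hc : 1 ≤ c) (y : ℕ) :
    maxNegHyperPMF (2 * n) n c y ≤
      maxNegHyperPMF (2 * n) n c 0 * Real.exp (1 - y / (3 * √(2 * c))) := by
  have hc1 : (1 : ℝ) ≤ c := by exact_mod_cast hc
  have h0 := maxNegHyperPMF_two_mul_nonneg n c 0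
  set s := √(2 * (c : ℝ)) with hs
  have hs1 : 1 ≤ s := by
    rw [hs, Real.one_le_sqrt]
    linarith
  have hs2 : (c : ℝ) = s ^ 2 / 2 := by
    rw [hs, Real.sq_sqrt (by positivity)]
    ring
  induction y with
  | zero => simpa using le_mul_of_one_le_right h0 (Real.one_le_exp zero_le_one)
  | succ y ih =>
    rcases le_or_gt ((y + 1 : ℕ) : ℝ) s with hys | hys
    · calc _ ≤ maxNegHyperPMF (2 * n) n c 0 *
            Real.exp (-((y + 1 : ℕ) * ((y + 1 : ℕ) - 1) / (4 * (c + (y + 1 : ℕ))))) :=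
            maxNegHyperPMF_two_mul_le_gaussian hc le_rfl
        _ ≤ _ := by
          gcongr
          have h1 : ((y + 1 : ℕ) : ℝ) / (3 * s) ≤ 1 := by
            rw [div_le_one (by positivity)]
            linarith
          have h2 : 0 ≤ ((y + 1 : ℕ) : ℝ) * ((y + 1 : ℕ) - 1) / (4 * (c + (y + 1 : ℕ))) := by
            push_cast
            rw [add_sub_cancel_right]
            positivity
          linarith
    · refine (maxNegHyperPMF_two_mul_succ_le hc y).trans ?_
      refine (mul_le_mul_of_nonneg_right ih (Real.exp_nonneg _)).trans ?_
      rw [mul_assoc, ← Real.exp_add]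
      gcongr
      push_cast at hys ⊢
      have h1 : 1 / (3 * s) ≤ ((y : ℝ) + 2) / (2 * (c + y + 1)) := by
        rw [div_le_div_iff₀ (by positivity) (by positivity), hs2]
        nlinarith
      have h2 : ((y : ℝ) + 1) / (3 * s) = y / (3 * s) + 1 / (3 * s) := by ring
      rw [h2]
      linarith

section Asymptotics

variable {n c : ℕ → ℕ}

theorem tendsto_sqrt_mul_maxNegHyperPMF_two_mul_zero (hc : Tendsto c atTop atTop)
    (hcn : Tendsto (fun k => (c k : ℝ) / n k) atTop (nhds 0)) (hle : ∀ k, c k ≤ n k) :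
    Tendsto (fun k => √(2 * c k) * maxNegHyperPMF (2 * n k) (n k) (c k) 0) atTop
      (nhds √(2 / Real.pi)) := by
  have hn : Tendsto n atTop atTop := tendsto_atTop_mono hle hc
  have hlt : ∀ᶠ k in atTop, 2 * c k ≤ n k := by
    filter_upwards [hcn.eventually (gt_mem_nhds (show (0 : ℝ) < 1 / 2 by norm_num)),
      hn.eventually_gt_atTop 0] with k h1 h2
    have h2' : (0 : ℝ) < n k := by exact_mod_cast h2
    rw [div_lt_iff₀ h2'] at h1
    have : (2 * c k : ℝ) ≤ n k := by linarith
    exact_mod_cast this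
  have hd : Tendsto (fun k => n k - c k) atTop atTop := by
    refine tendsto_atTop_mono' _ ?_ hc
    filter_upwards [hlt] with k hk
    omega
  have hw := tendsto_centralBinom_mul_sqrt_div
  have hpi : 1 / √Real.pi ≠ 0 := by positivity
  have hratio : Tendsto (fun k => √(2 / (1 - (c k : ℝ) / n k))) atTop (nhds √2) := by
    have := (tendsto_const_nhds (x := (2 : ℝ))).div
      ((tendsto_const_nhds (x := (1 : ℝ))).sub hcn) (by norm_num)
    simpa using this.sqrt
  have h := ((((hw.comp hc).mul (hw.comp hd)).div (hw.comp hn) hpi).mul hratio)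
  have hlim : 1 / √Real.pi * (1 / √Real.pi) / (1 / √Real.pi) * √2 = √(2 / Real.pi) := by
    rw [Real.sqrt_div (by norm_num)]
    field_simp
  rw [hlim] at h
  refine h.congr' ?_
  filter_upwards [hlt, hc.eventually_ge_atTop 1] with k hk hk1
  rw [maxNegHyperPMF_two_mul_zero hk1 (hle k)]
  obtain ⟨d, hd'⟩ := Nat.exists_eq_add_of_le (hle k)
  simp only [Function.comp, Pi.div_apply]
  have hd1 : 1 ≤ d := by omega
  rw [hd', Nat.add_sub_cancel_left]
  have hc0 : (0 : ℝ) < c k := by positivity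
  have hd0 : (0 : ℝ) < d := by positivity
  have h1 : 2 / (1 - (c k : ℝ) / (c k + d : ℕ)) = 2 * (c k + d : ℕ) / d := by
    push_cast
    have : (c k : ℝ) + d ≠ 0 := by positivity
    field_simp
    simp [hd0.ne']
  rw [h1, Real.sqrt_div (by positivity), Real.sqrt_mul (by norm_num), Real.sqrt_mul (by norm_num),
    pow_add]
  have hb : ((c k + d).centralBinom : ℝ) ≠ 0 := by
    exact_mod_cast (Nat.centralBinom_pos _).ne'
  have h2 : √((c k + d : ℕ) : ℝ) ≠ 0 := by positivity
  have h3 : √(d : ℝ) ≠ 0 := by positivity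
  field_simp

theorem tendsto_sqrt_mul_maxNegHyperPMF_two_mul_floor (hc : Tendsto c atTop atTop)
    (hcn : Tendsto (fun k => (c k : ℝ) / n k) atTop (nhds 0)) (hle : ∀ k, c k ≤ n k)
    {x : ℝ} (hx : 0 ≤ x) :
    Tendsto (fun k => √(2 * c k) *
        maxNegHyperPMF (2 * n k) (n k) (c k) ⌊√(2 * c k) * x⌋₊) atTop
      (nhds (√(2 / Real.pi) * Real.exp (-x ^ 2 / 2))) := by
  have h0 := tendsto_sqrt_mul_maxNegHyperPMF_two_mul_zero hc hcn hle
  have hs : Tendsto (fun k => √(2 * (c k : ℝ))) atTop atTop :=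
    Real.tendsto_sqrt_atTop.comp
      ((tendsto_natCast_atTop_atTop.comp hc).const_mul_atTop (by norm_num))
  have hsi := tendsto_inv_atTop_zero.comp hs
  have hn : Tendsto n atTop atTop := tendsto_atTop_mono hle hc
  set y : ℕ → ℕ := fun k => ⌊√(2 * (c k : ℝ)) * x⌋₊ with hy
  have hyx : Tendsto (fun k => (y k : ℝ) / √(2 * c k)) atTop (nhds x) := by
    refine ((tendsto_nat_floor_mul_div_atTop hx).comp hs).congr fun k => ?_
    simp only [hy, Function.comp, mul_comm x]
  have hsq (k : ℕ) : (c k : ℝ) = √(2 * c k) ^ 2 / 2 := by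
    rw [Real.sq_sqrt (by positivity)]
    ring
  have hev : ∀ᶠ k in atTop, 1 ≤ c k ∧ 0 < √(2 * (c k : ℝ)) ∧ (0 : ℝ) < n k := by
    filter_upwards [hc.eventually_ge_atTop 1, hs.eventually_gt_atTop 0, hn.eventually_gt_atTop 0]
      with k h1 h2 h3
    exact ⟨h1, h2, by exact_mod_cast h3⟩
  have hyn : Tendsto (fun k => (y k : ℝ) / n k) atTop (nhds 0) := by
    have := ((hyx.mul hsi).mul (hcn.const_mul 2))
    simp only [mul_zero] at this
    refine this.congr' ?_
    filter_upwards [hev] with k hk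
    obtain ⟨-, hk1, hk2⟩ := hk
    simp only [Function.comp]
    set s := √(2 * (c k : ℝ))
    have hck : (c k : ℝ) = s ^ 2 / 2 := hsq k
    rw [hck]
    field_simp
  have hrem : Tendsto (fun k => 1 - (c k : ℝ) / n k - y k / n k) atTop (nhds 1) := by
    simpa using ((tendsto_const_nhds (x := (1 : ℝ))).sub hcn).sub hyn
  have hlt : ∀ᶠ k in atTop, c k + y k < n k := by
    filter_upwards [hev, hrem.eventually (lt_mem_nhds zero_lt_one)] with k hk hk'
    obtain ⟨-, -, hk2⟩ := hk
    rw [sub_sub, ← add_div, sub_pos, div_lt_one hk2] at hk'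
    exact_mod_cast hk'
  have hupper : Tendsto (fun k => (y k : ℝ) * (y k - 1) / (4 * (c k + y k))) atTop
      (nhds (x ^ 2 / 2)) := by
    have h1 := (hyx.mul (hyx.sub hsi)).div
      (((tendsto_const_nhds (x := (1 / 2 : ℝ))).add (hyx.mul hsi)).const_mul 4) (by norm_num)
    rw [show x * (x - 0) / (4 * (1 / 2 + x * 0)) = x ^ 2 / 2 by ring] at h1
    refine h1.congr' ?_
    filter_upwards [hev] with k hk
    obtain ⟨-, hk1, -⟩ := hk
    simp only [Function.comp, Pi.div_apply]
    set s := √(2 * (c k : ℝ))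
    have hck : (c k : ℝ) = s ^ 2 / 2 := hsq k
    rw [hck]
    field_simp
  have hlower : Tendsto (fun k => ((y k : ℝ) ^ 2 + 3 * y k) / (4 * c k) +
      y k * y k / (n k - c k - y k)) atTop (nhds (x ^ 2 / 2)) := by
    have h1 := (((hyx.pow 2).add ((hyx.mul hsi).const_mul 3)).div_const 2).add
      ((hyx.pow 2).mul ((hcn.const_mul 2).div hrem one_ne_zero))
    rw [show (x ^ 2 + 3 * (x * 0)) / 2 + x ^ 2 * (2 * 0 / 1) = x ^ 2 / 2 by ring] at h1
    refine h1.congr' ?_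
    filter_upwards [hev, hlt] with k hk hk'
    obtain ⟨-, hk1, hk2⟩ := hk
    have hk3 : (n k : ℝ) - c k - y k ≠ 0 := by
      have : (c k : ℝ) + y k < n k := by exact_mod_cast hk'
      intro h
      linarith
    have hk4 : 1 - (c k : ℝ) / n k - y k / n k = (n k - c k - y k) / n k := by
      field_simp
    simp only [Function.comp, Pi.div_apply]
    rw [hk4]
    set s := √(2 * (c k : ℝ))
    have hck : (c k : ℝ) = s ^ 2 / 2 := hsq k
    generalize (n k : ℝ) - c k - y k = u at hk3
    rw [hck]
    field_simp
    ring
  have hexp : Real.exp (-x ^ 2 / 2) = Real.exp (-(x ^ 2 / 2)) := by ring_nf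
  rw [hexp]
  refine tendsto_of_tendsto_of_tendsto_of_le_of_le'
    (h0.mul ((Real.continuous_exp.tendsto _).comp hlower.neg))
    (h0.mul ((Real.continuous_exp.tendsto _).comp hupper.neg)) ?_ ?_
  · filter_upwards [hev, hlt] with k hk hk'
    simp only [Function.comp]
    rw [mul_assoc]
    gcongr
    exact gaussian_le_maxNegHyperPMF_two_mul hk.1 le_rfl hk'
  · filter_upwards [hev] with k hk
    simp only [Function.comp]
    rw [mul_assoc]
    gcongr
    exact maxNegHyperPMF_two_mul_le_gaussian hk.1 le_rfl

theorem tendsto_sum_maxNegHyperPMF_two_mul (hc : Tendsto c atTop atTop)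
    (hcn : Tendsto (fun k => (c k : ℝ) / n k) atTop (nhds 0)) (hle : ∀ k, c k ≤ n k)
    {h : ℝ → ℝ} (hcont : Continuous h) {M : ℝ} (hM : ∀ x, |h x| ≤ M) :
    Tendsto (fun k => ∑ y ∈ Finset.range (n k - c k + 1),
        maxNegHyperPMF (2 * n k) (n k) (c k) y * h (y / √(2 * c k))) atTop
      (nhds (∫ x in Set.Ioi (0 : ℝ), h x * √(2 / Real.pi) * Real.exp (-x ^ 2 / 2))) := by
  have hs : Tendsto (fun k => √(2 * (c k : ℝ))) atTop atTop :=
    Real.tendsto_sqrt_atTop.comp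
      ((tendsto_natCast_atTop_atTop.comp hc).const_mul_atTop (by norm_num))
  have h0 := tendsto_sqrt_mul_maxNegHyperPMF_two_mul_zero hc hcn hle
  have hM0 : 0 ≤ M := (abs_nonneg _).trans (hM 0)
  set K := √(2 / Real.pi) + 1
  have key : Tendsto (fun k => ∫ x in Set.Ioi (0 : ℝ), √(2 * c k) *
      maxNegHyperPMF (2 * n k) (n k) (c k) ⌊√(2 * c k) * x⌋₊ *
        h (⌊√(2 * c k) * x⌋₊ / √(2 * c k))) atTop
      (nhds (∫ x in Set.Ioi (0 : ℝ), h x * √(2 / Real.pi) * Real.exp (-x ^ 2 / 2))) := by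
    refine MeasureTheory.tendsto_integral_filter_of_dominated_convergence
      (fun x => K * Real.exp 2 * M * Real.exp (-(1 / 3) * x)) ?_ ?_ ?_ ?_
    · refine Eventually.of_forall fun k => Measurable.aestronglyMeasurable ?_
      have hf : Measurable fun x : ℝ => ⌊√(2 * c k) * x⌋₊ :=
        Nat.measurable_floor.comp (measurable_id.const_mul _)
      have hg : Measurable fun y : ℕ => √(2 * c k) * maxNegHyperPMF (2 * n k) (n k) (c k) y *
          h (y / √(2 * c k)) := measurable_from_top
      exact hg.comp hf
    · filter_upwards [h0.eventually (gt_mem_nhds (lt_add_one _)), hc.eventually_ge_atTop 1,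
        hs.eventually_ge_atTop 1] with k hk hk1 hs1
      filter_upwards [MeasureTheory.ae_restrict_mem measurableSet_Ioi] with x hx
      have hp := maxNegHyperPMF_two_mul_nonneg (n k) (c k) ⌊√(2 * c k) * x⌋₊
      rw [Real.norm_eq_abs, abs_mul, abs_of_nonneg (by positivity)]
      have hp0 := maxNegHyperPMF_two_mul_nonneg (n k) (c k) 0
      have h1 := maxNegHyperPMF_two_mul_le_exp (n := n k) hk1 ⌊√(2 * c k) * x⌋₊
      have h2 := Nat.lt_floor_add_one (√(2 * c k) * x)
      set s := √(2 * (c k : ℝ))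
      have h3 : 1 - (⌊s * x⌋₊ : ℝ) / (3 * s) ≤ 2 + -(1 / 3) * x := by
        have : x / 3 - 1 ≤ (⌊s * x⌋₊ : ℝ) / (3 * s) := by
          rw [le_div_iff₀ (by positivity)]
          linarith
        linarith
      calc s * maxNegHyperPMF (2 * n k) (n k) (c k) ⌊s * x⌋₊ * |h (⌊s * x⌋₊ / s)|
          ≤ s * (maxNegHyperPMF (2 * n k) (n k) (c k) 0 * Real.exp (2 + -(1 / 3) * x)) * M := by
            gcongr
            · exact h1.trans (mul_le_mul_of_nonneg_left (Real.exp_le_exp.2 h3) hp0)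
            · exact hM _
        _ = s * maxNegHyperPMF (2 * n k) (n k) (c k) 0 *
            (Real.exp 2 * M * Real.exp (-(1 / 3) * x)) := by
            rw [Real.exp_add]
            ring
        _ ≤ K * (Real.exp 2 * M * Real.exp (-(1 / 3) * x)) := by gcongr
        _ = _ := by ring
    · exact (exp_neg_integrableOn_Ioi 0 (by norm_num : (0 : ℝ) < 1 / 3)).const_mul _
    · filter_upwards [MeasureTheory.ae_restrict_mem measurableSet_Ioi] with x hx
      have hx0 : 0 ≤ x := le_of_lt hx
      have h1 := tendsto_sqrt_mul_maxNegHyperPMF_two_mul_floor hc hcn hle hx0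
      have h2 : Tendsto (fun k => (⌊√(2 * (c k : ℝ)) * x⌋₊ : ℝ) / √(2 * c k)) atTop (nhds x) := by
        refine ((tendsto_nat_floor_mul_div_atTop hx0).comp hs).congr fun k => ?_
        simp only [Function.comp, mul_comm x]
      have h3 := h1.mul ((hcont.tendsto x).comp h2)
      rw [show h x * √(2 / Real.pi) * Real.exp (-x ^ 2 / 2) =
        √(2 / Real.pi) * Real.exp (-x ^ 2 / 2) * h x by ring]
      exact h3
  refine key.congr' ?_
  filter_upwards [hs.eventually_gt_atTop 0] with k hk
  rw [MeasureTheory.integral_comp_mul_left_Ioi (fun x => √(2 * c k) *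
      maxNegHyperPMF (2 * n k) (n k) (c k) ⌊x⌋₊ * h (⌊x⌋₊ / √(2 * c k))) 0 hk, mul_zero,
    integral_Ioi_comp_floor (fun y => √(2 * c k) * maxNegHyperPMF (2 * n k) (n k) (c k) y *
      h (y / √(2 * c k))) (M := n k - c k + 1), smul_eq_mul, Finset.mul_sum]
  · refine Finset.sum_congr rfl fun y _ => ?_
    field_simp
  · intro y hy
    rw [maxNegHyperPMF_two_mul_eq_zero (by omega)]
    simp

end Asymptotics

/-- Lemma 3: if `m = N/2` and `c` grows like `√N`, then `Y/√(2c)` converges in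
distribution to the standard half-normal distribution. -/
theorem maxNegHyper_halfNormal_limit
    (N : ℕ → ℕ) (c : ℕ → ℕ)
    (hNeven : ∀ k, Even (N k))
    (hN : Tendsto (fun k => (N k : ℝ)) atTop atTop)
    (hc : Tendsto (fun k => (c k : ℝ) / Real.sqrt (N k)) atTop (nhds 1))
    (hbounds : ∀ k, 1 ≤ c k ∧ c k ≤ N k / 2) :
    ∀ h : ℝ → ℝ, Continuous h → (∃ M : ℝ, ∀ x, |h x| ≤ M) →
      Tendsto
        (fun k => ∑ y ∈ Finset.range
            (max (N k / 2 - c k) (N k - N k / 2 - c k) + 1),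
          maxNegHyperPMF (N k) (N k / 2) (c k) y * h (y / Real.sqrt (2 * c k)))
        atTop
        (nhds (∫ x in Set.Ioi (0:ℝ),
          h x * Real.sqrt (2 / Real.pi) * Real.exp (-x^2 / 2))) := by
  intro h hcont ⟨M, hM⟩
  obtain ⟨n, rfl⟩ : ∃ n : ℕ → ℕ, N = fun k => 2 * n k :=
    ⟨fun k => N k / 2, funext fun k => (Nat.mul_div_cancel' (hNeven k).two_dvd).symm⟩
  have hdiv (k : ℕ) : 2 * n k / 2 = n k := by omega
  have hsub (k : ℕ) : 2 * n k - n k - c k = n k - c k := by omega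
  simp only [hdiv] at hbounds
  simp only [hdiv, hsub, max_self]
  have hsqrt : Tendsto (fun k => √((2 * n k : ℕ) : ℝ)) atTop atTop :=
    Real.tendsto_sqrt_atTop.comp hN
  have hpos := hsqrt.eventually_gt_atTop 0
  have hctop : Tendsto c atTop atTop := by
    rw [← tendsto_natCast_atTop_iff (R := ℝ)]
    refine (hc.pos_mul_atTop one_pos hsqrt).congr' ?_
    filter_upwards [hpos] with k hk
    field_simp
  have hcn : Tendsto (fun k => (c k : ℝ) / n k) atTop (nhds 0) := by
    have h1 := (hc.mul (tendsto_inv_atTop_zero.comp hsqrt)).const_mul 2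
    rw [mul_zero, mul_zero] at h1
    refine h1.congr' ?_
    filter_upwards [hpos] with k hk
    have h2 : √((2 * n k : ℕ) : ℝ) * √((2 * n k : ℕ) : ℝ) = 2 * n k := by
      rw [Real.mul_self_sqrt (by positivity)]
      push_cast
      ring
    simp only [Function.comp]
    rw [← div_eq_mul_inv, div_div, h2]
    ring
  exact tendsto_sum_maxNegHyperPMF_two_mul hctop hcn (fun k => (hbounds k).2) hcont hM
end
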